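/- Let G be a finite undirected graph, possibly with loops, with no isolated vertices, and let B_G be its bipartite double cover (V(B_G) = V ∪ V', with edges v'w and w'v for every edge vw ∈ E, a loop vv yielding the single edge v'v). Then G contains a cycle, or two looped vertices joined by a path, or one of the graphs H_1, H_2, H_3, H_4 as a subgraph, if and only if B_G contains a cycle or a 3-spider as a subgraph. -/

import Mathlib

/-- `nbhd adj A` is the set of vertices having at least one neighbor in `A`
(for the symmetric adjacency relation `adj`, which may have loops). -/
def nbhd {V : Type*} (adj : V → V → Prop) (A : Set V) : Set V :=
  {v | ∃ u ∈ A, adj u v}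

/-- Rabbit territory at (0-indexed) time `t` against the hunter strategy `W`,
when the rabbit may start anywhere in `S`.  (`terr adj S W (t-1)` is the set `R_t`
of the paper: `R_1 = S \ W_1`, `R_t = N(R_{t-1}) \ W_t`.) -/
def terr {V : Type*} (adj : V → V → Prop) (S : Set V) (W : ℕ → Set V) : ℕ → Set V
  | 0 => S \ W 0
  | t + 1 => nbhd adj (terr adj S W t) \ W (t + 1)

/-- The hunter strategy `W` uses at most `k` hunters. -/
def UsesAtMost {V : Type*} (W : ℕ → Set V) (k : ℕ) : Prop :=
  ∀ t, (W t).ncard ≤ k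

/-- The hunting number when the rabbit is restricted to start in `S`:
the least `k` for which some strategy using `k` hunters empties the territory. -/
noncomputable def huntingNumberFrom {V : Type*} (adj : V → V → Prop) (S : Set V) : ℕ :=
  sInf {k | ∃ W : ℕ → Set V, UsesAtMost W k ∧ ∃ T, terr adj S W T = ∅}

/-- The hunting number `h(G)`. -/
noncomputable def huntingNumber {V : Type*} (adj : V → V → Prop) : ℕ :=
  huntingNumberFrom adj Set.univ

/-- The hunting number with time limit `l ≥ 1`, `h(G,l)`:
the strategy `W_1, …, W_l` corresponds to indices `0, …, l-1`, and the rabbit must be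
caught by round `l`, i.e. `R_l = terr … (l-1) = ∅`. -/
noncomputable def huntingNumberTL {V : Type*} (adj : V → V → Prop) (l : ℕ) : ℕ :=
  sInf {k | ∃ W : ℕ → Set V, UsesAtMost W k ∧ terr adj Set.univ W (l - 1) = ∅}

/-- `G` contains a cycle as a subgraph: distinct vertices `v_0, …, v_{m-1}` (`m ≥ 3`)
with `v_i v_{i+1 mod m}` an edge for every `i` (a loop does not count as a cycle). -/
def HasCycle {V : Type*} (adj : V → V → Prop) : Prop :=
  ∃ (m : ℕ) (v : Fin (m + 3) → V), Function.Injective v ∧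
    ∀ i : Fin (m + 3), adj (v i) (v (i + 1))

/-- `G` contains two looped vertices joined by a path: distinct vertices
`v_0, …, v_{m+1}` (so at least two of them) forming a path, with loops at the
two endpoints `v_0` and `v_{m+1}`. -/
def HasTwoLoopsJoinedByPath {V : Type*} (adj : V → V → Prop) : Prop :=
  ∃ (m : ℕ) (v : Fin (m + 2) → V), Function.Injective v ∧
    (∀ i : Fin (m + 1), adj (v i.castSucc) (v i.succ)) ∧
    adj (v 0) (v 0) ∧ adj (v (Fin.last (m + 1))) (v (Fin.last (m + 1)))

/-- `G` contains the 3-spider `H_1`: a center `x` with three internally disjoint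
paths `x a_i b_i c_i` of length 3 (all ten vertices distinct). -/
def HasH1 {V : Type*} (adj : V → V → Prop) : Prop :=
  ∃ x a1 b1 c1 a2 b2 c2 a3 b3 c3 : V,
    ([x, a1, b1, c1, a2, b2, c2, a3, b3, c3] : List V).Nodup ∧
    adj x a1 ∧ adj a1 b1 ∧ adj b1 c1 ∧
    adj x a2 ∧ adj a2 b2 ∧ adj b2 c2 ∧
    adj x a3 ∧ adj a3 b3 ∧ adj b3 c3

/-- `G` contains `H_2`: paths `c_1 b_1 a_1 x a_2 b_2 c_2` and `x a_3 b_3` sharing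
only the vertex `x` (all nine vertices distinct), with a loop at `b_3`. -/
def HasH2 {V : Type*} (adj : V → V → Prop) : Prop :=
  ∃ x a1 b1 c1 a2 b2 c2 a3 b3 : V,
    ([x, a1, b1, c1, a2, b2, c2, a3, b3] : List V).Nodup ∧
    adj x a1 ∧ adj a1 b1 ∧ adj b1 c1 ∧
    adj x a2 ∧ adj a2 b2 ∧ adj b2 c2 ∧
    adj x a3 ∧ adj a3 b3 ∧ adj b3 b3

/-- `G` contains `H_3`: paths `c_1 b_1 a_1 x a_2 b_2 c_2` and `x a_3` sharing
only the vertex `x` (all eight vertices distinct), with a loop at `a_3`. -/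
def HasH3 {V : Type*} (adj : V → V → Prop) : Prop :=
  ∃ x a1 b1 c1 a2 b2 c2 a3 : V,
    ([x, a1, b1, c1, a2, b2, c2, a3] : List V).Nodup ∧
    adj x a1 ∧ adj a1 b1 ∧ adj b1 c1 ∧
    adj x a2 ∧ adj a2 b2 ∧ adj b2 c2 ∧
    adj x a3 ∧ adj a3 a3

/-- `G` contains `H_4`: a path `c_1 b_1 a_1 x a_2 b_2 c_2` (all seven vertices
distinct) with a loop at the middle vertex `x`. -/
def HasH4 {V : Type*} (adj : V → V → Prop) : Prop :=
  ∃ x a1 b1 c1 a2 b2 c2 : V,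
    ([x, a1, b1, c1, a2, b2, c2] : List V).Nodup ∧
    adj x a1 ∧ adj a1 b1 ∧ adj b1 c1 ∧
    adj x a2 ∧ adj a2 b2 ∧ adj b2 c2 ∧
    adj x x

/-- The bipartite double cover `B_G` of a graph (with loops) `G`:
vertex set `V ⊕ V` (the right summand is the copy `V'`), with edges `v'w` and `w'v`
for every edge `vw` of `G` (a loop `vv` yields the single edge `v'v`). -/
def adjB {V : Type*} (adj : V → V → Prop) : V ⊕ V → V ⊕ V → Prop
  | Sum.inl v, Sum.inr w => adj v w
  | Sum.inr v, Sum.inl w => adj v w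
  | Sum.inl _, Sum.inl _ => False
  | Sum.inr _, Sum.inr _ => False

/-- A closed walk which neither stays at a vertex nor immediately backtracks yields a cycle. -/
theorem hasCycle_of_nonbacktracking {V : Type*} {adj : V → V → Prop} (n : ℕ) :
    ∀ p : ℕ → V, 0 < n → p 0 = p n → (∀ i < n, adj (p i) (p (i + 1))) →
      (∀ i < n, p i ≠ p (i + 1)) → (∀ i, i + 1 < n → p i ≠ p (i + 2)) → HasCycle adj := by
  induction n using Nat.strong_induction_on with
  | _ n ih =>
    intro p hn hp hadj hstay hback
    by_cases hinj : ∃ i j, i < j ∧ j < n ∧ p i = p j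
    · obtain ⟨i, j, hij, hjn, hpij⟩ := hinj
      refine ih (j - i) (by omega) (fun k => p (i + k)) (by omega) ?_ ?_ ?_ ?_
      · simpa [Nat.add_sub_cancel' hij.le] using hpij
      · exact fun k hk => hadj (i + k) (by omega)
      · exact fun k hk => hstay (i + k) (by omega)
      · exact fun k hk => hback (i + k) (by omega)
    · push Not at hinj
      have h1 : n ≠ 1 := by
        rintro rfl
        exact hstay 0 (by omega) hp
      have h2 : n ≠ 2 := by
        rintro rfl
        exact hback 0 (by omega) hp
      obtain ⟨m, rfl⟩ : ∃ m, n = m + 3 := ⟨n - 3, by omega⟩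
      refine ⟨m, fun i => p i, ?_, ?_⟩
      · intro i j hij
        rcases lt_trichotomy i.val j.val with h | h | h
        · exact absurd hij (hinj _ _ h j.isLt)
        · exact Fin.ext h
        · exact absurd hij.symm (hinj _ _ h i.isLt)
      · intro i
        have h := hadj i i.isLt
        rcases eq_or_ne i (Fin.last (m + 2)) with rfl | hi
        · simpa [hp] using h
        · beta_reduce
          rw [Fin.val_add_one_of_lt (Fin.lt_last_iff_ne_last.2 hi)]
          exact h

/-- Two distinct looped vertices joined by a walk are joined by a path. -/
theorem hasTwoLoopsJoinedByPath_of_walk {V : Type*} {adj : V → V → Prop} (n : ℕ) :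
    ∀ p : ℕ → V, p 0 ≠ p n → (∀ i < n, adj (p i) (p (i + 1))) →
      adj (p 0) (p 0) → adj (p n) (p n) → HasTwoLoopsJoinedByPath adj := by
  induction n using Nat.strong_induction_on with
  | _ n ih =>
    intro p hne hadj h0 hn
    by_cases hinj : ∃ i j, i < j ∧ j ≤ n ∧ p i = p j
    · obtain ⟨i, j, hij, hjn, hpij⟩ := hinj
      have hlast : (if n - (j - i) ≤ i then p (n - (j - i)) else p (n - (j - i) + (j - i)))
          = p n := by
        split_ifs with h
        · obtain rfl : j = n := by omega
          rw [← hpij]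
          congr 1
          omega
        · congr 1
          omega
      refine ih (n - (j - i)) (by omega)
        (fun k => if k ≤ i then p k else p (k + (j - i))) ?_ ?_ ?_ ?_
      · simpa only [hlast, Nat.zero_le, if_true] using hne
      · intro k hk
        rcases lt_trichotomy k i with h | rfl | h
        · simpa [h.le, Nat.succ_le_of_lt h] using hadj k (by omega)
        · have := hadj j (by omega)
          simp only [le_refl, if_true, Nat.not_succ_le_self, if_false]
          rw [hpij, show k + 1 + (j - k) = j + 1 by omega]
          exact this
        · have := hadj (k + (j - i)) (by omega)
          simp only [show ¬ k ≤ i by omega, show ¬ k + 1 ≤ i by omega, if_false]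
          rw [show k + 1 + (j - i) = k + (j - i) + 1 by omega]
          exact this
      · simpa using h0
      · simpa only [hlast] using hn
    · push Not at hinj
      obtain ⟨m, rfl⟩ : ∃ m, n = m + 1 :=
        Nat.exists_eq_succ_of_ne_zero (by rintro rfl; exact hne rfl)
      refine ⟨m, fun i => p i, ?_, fun i => by simpa using hadj i i.isLt, by simpa using h0,
        by simpa using hn⟩
      intro i j hij
      rcases lt_trichotomy i.val j.val with h | h | h
      · exact absurd hij (hinj _ _ h (by omega))
      · exact Fin.ext h
      · exact absurd hij.symm (hinj _ _ h (by omega))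

theorem hasTwoLoopsJoinedByPath_of_reflTransGen {V : Type*} {adj : V → V → Prop} {u v : V}
    (huv : Relation.ReflTransGen adj u v) (hne : u ≠ v) (hu : adj u u) (hv : adj v v) :
    HasTwoLoopsJoinedByPath adj := by
  obtain ⟨n, p, rfl, rfl, hadj⟩ : ∃ (n : ℕ) (p : ℕ → V), p 0 = u ∧ p n = v ∧
      ∀ i < n, adj (p i) (p (i + 1)) := by
    clear hne hv
    induction huv with
    | refl => exact ⟨0, fun _ => u, rfl, rfl, by simp⟩
    | @tail b c _ hbc ih =>
      obtain ⟨n, p, h0, hn, hadj⟩ := ih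
      refine ⟨n + 1, fun k => if k ≤ n then p k else c, by simpa using h0, by simp, ?_⟩
      intro i hi
      rcases Nat.lt_succ_iff_lt_or_eq.1 hi with h | rfl
      · simpa [h.le, Nat.succ_le_of_lt h] using hadj i h
      · simpa [hn] using hbc
  exact hasTwoLoopsJoinedByPath_of_walk n p hne hadj hu hv

theorem hasCycle_of_triangle {V : Type*} {adj : V → V → Prop} {x y z : V}
    (h : [x, y, z].Nodup) (hxy : adj x y) (hyz : adj y z) (hzx : adj z x) : HasCycle adj :=
  ⟨0, [x, y, z].get, List.nodup_iff_injective_get.1 h, by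
    intro i
    fin_cases i <;> assumption⟩

theorem hasCycle_of_pentagon {V : Type*} {adj : V → V → Prop} {x y z u w : V}
    (h : [x, y, z, u, w].Nodup) (hxy : adj x y) (hyz : adj y z) (hzu : adj z u)
    (huw : adj u w) (hwx : adj w x) : HasCycle adj :=
  ⟨2, [x, y, z, u, w].get, List.nodup_iff_injective_get.1 h, by
    intro i
    fin_cases i <;> assumption⟩

/-- The projection of the bipartite double cover onto the base graph. -/
def coverProj {V : Type*} : V ⊕ V → V := Sum.elim id id

theorem adj_coverProj {V : Type*} {adj : V → V → Prop} {v w : V ⊕ V} (h : adjB adj v w) :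
    adj (coverProj v) (coverProj w) := by
  rcases v with v | v <;> rcases w with w | w <;> simp_all [adjB, coverProj]

theorem isLeft_ne_of_adjB {V : Type*} {adj : V → V → Prop} {v w : V ⊕ V} (h : adjB adj v w) :
    w.isLeft = !v.isLeft := by
  rcases v with v | v <;> rcases w with w | w <;> simp_all [adjB]

theorem eq_of_coverProj_eq {V : Type*} {v w : V ⊕ V} (h : coverProj v = coverProj w)
    (hs : v.isLeft = w.isLeft) : v = w := by
  rcases v with v | v <;> rcases w with w | w <;> simp_all [coverProj]

/-- The lift of a walk to the double cover, alternating between the two sides. -/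
def coverLift {V : Type*} (p : ℕ → V) (n : ℕ) : V ⊕ V :=
  if Even n then Sum.inl (p n) else Sum.inr (p n)

theorem coverProj_coverLift {V : Type*} (p : ℕ → V) (n : ℕ) :
    coverProj (coverLift p n) = p n := by
  unfold coverLift
  split_ifs <;> rfl

theorem adjB_coverLift {V : Type*} {adj : V → V → Prop} {p : ℕ → V} {n : ℕ}
    (h : adj (p n) (p (n + 1))) : adjB adj (coverLift p n) (coverLift p (n + 1)) := by
  unfold coverLift
  by_cases hn : Even n <;> simpa [hn, Nat.even_add_one, adjB] using h

theorem hasCycle_adjB_of_walk {V : Type*} {adj : V → V → Prop} {n : ℕ} {p : ℕ → V}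
    (hn : 0 < n) (heven : Even n) (hp : p 0 = p n) (hadj : ∀ i < n, adj (p i) (p (i + 1)))
    (hback : ∀ i, i + 1 < n → p i ≠ p (i + 2)) : HasCycle (adjB adj) := by
  refine hasCycle_of_nonbacktracking n (coverLift p) hn ?_
    (fun i hi => adjB_coverLift (hadj i hi)) ?_ ?_
  · simp [coverLift, heven, hp]
  · intro i hi h
    have := isLeft_ne_of_adjB (adjB_coverLift (hadj i hi))
    rw [← h] at this
    exact (Bool.eq_not_self _).1 this
  · intro i hi h
    apply hback i hi
    simpa only [coverProj_coverLift] using congrArg coverProj h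

theorem HasCycle.exists_periodic {V : Type*} {adj : V → V → Prop} (h : HasCycle adj) :
    ∃ (N : ℕ) (p : ℕ → V), 3 ≤ N ∧ (∀ i j, p i = p j ↔ i ≡ j [MOD N]) ∧
      ∀ i, adj (p i) (p (i + 1)) := by
  obtain ⟨m, v, hv, hadj⟩ := h
  refine ⟨m + 3, fun i => v (Fin.ofNat (m + 3) i), by omega, ?_, ?_⟩
  · intro i j
    rw [hv.eq_iff, Fin.ext_iff]
    rfl
  · intro i
    convert hadj (Fin.ofNat (m + 3) i) using 2
    ext
    simp [Fin.val_add]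

theorem not_modEq_add {N d : ℕ} (i : ℕ) (hd : 0 < d) (hN : d < N) : ¬ i ≡ i + d [MOD N] := by
  intro h
  have h' : 0 ≡ d [MOD N] := Nat.ModEq.add_left_cancel' i (by simpa using h)
  have := (Nat.modEq_zero_iff_dvd.1 h'.symm)
  exact absurd (Nat.le_of_dvd hd this) (by omega)

theorem HasCycle.doubleCover {V : Type*} {adj : V → V → Prop} (h : HasCycle adj) :
    HasCycle (adjB adj) := by
  obtain ⟨N, p, hN, hp, hadj⟩ := h.exists_periodic
  refine hasCycle_adjB_of_walk (n := 2 * N) (p := p) (by omega) (even_two_mul N) ?_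
    (fun i _ => hadj i) ?_
  · rw [hp]
    exact ((Nat.modEq_zero_iff_dvd).2 (dvd_mul_left N 2)).symm
  · intro i _
    rw [Ne, hp]
    exact not_modEq_add i (by omega) (by omega)

theorem HasTwoLoopsJoinedByPath.hasCycle_doubleCover {V : Type*} {adj : V → V → Prop}
    (hsymm : Symmetric adj) (h : HasTwoLoopsJoinedByPath adj) : HasCycle (adjB adj) := by
  obtain ⟨m, v, hv, hadj, h0, hlast⟩ := h
  obtain ⟨q, hq, hqadj, hq0, hqm⟩ : ∃ q : ℕ → V, (∀ i j, i ≤ m + 1 → j ≤ m + 1 → q i = q j → i = j) ∧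
      (∀ i, i ≤ m → adj (q i) (q (i + 1))) ∧ adj (q 0) (q 0) ∧ adj (q (m + 1)) (q (m + 1)) := by
    refine ⟨fun i => v (Fin.ofNat (m + 2) i), ?_, ?_, ?_, ?_⟩
    · intro i j hi hj hij
      have := congrArg Fin.val (hv hij)
      simpa [Nat.mod_eq_of_lt (show i < m + 2 by omega),
        Nat.mod_eq_of_lt (show j < m + 2 by omega)] using this
    · intro i hi
      convert hadj ⟨i, by omega⟩ using 2 <;> ext <;>
        simp [Nat.mod_eq_of_lt (show i < m + 2 by omega),
          Nat.mod_eq_of_lt (show i + 1 < m + 2 by omega)]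
    · exact h0
    · convert hlast using 2 <;> ext <;> simp
  let f : ℕ → ℕ := fun i => if i ≤ m + 1 then i else 2 * m + 3 - i
  refine hasCycle_adjB_of_walk (n := 2 * m + 4) (p := fun i => q (f i)) (by omega)
    ⟨m + 2, by omega⟩ (congrArg q (by grind)) ?_ ?_
  · intro i hi
    rcases lt_trichotomy i (m + 1) with h | h | h
    · rw [show f i = i by grind, show f (i + 1) = i + 1 by grind]
      exact hqadj i (by omega)
    · rw [show f i = m + 1 by grind, show f (i + 1) = m + 1 by grind]
      exact hqm
    · rcases Nat.lt_or_ge i (2 * m + 3) with h' | h'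
      · rw [show f i = f (i + 1) + 1 by grind]
        exact hsymm (hqadj _ (by grind))
      · rw [show f i = 0 by grind, show f (i + 1) = 0 by grind]
        exact hq0
  · intro i hi h
    have := hq _ _ (by grind) (by grind) h
    grind

theorem hasCycle_or_hasTwoLoops_of_hasCycle_adjB {V : Type*} {adj : V → V → Prop}
    (h : HasCycle (adjB adj)) : HasCycle adj ∨ HasTwoLoopsJoinedByPath adj := by
  obtain ⟨N, w, hN, hw, hwadj⟩ := h.exists_periodic
  have hadj : ∀ i, adj (coverProj (w i)) (coverProj (w (i + 1))) :=
    fun i => adj_coverProj (hwadj i)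
  have hside : ∀ i, (w (i + 1)).isLeft = !(w i).isLeft := fun i => isLeft_ne_of_adjB (hwadj i)
  have hback : ∀ i, coverProj (w i) ≠ coverProj (w (i + 2)) := by
    intro i hi
    refine not_modEq_add i (d := 2) (by omega) (by omega) ((hw _ _).1 (eq_of_coverProj_eq hi ?_))
    rw [hside (i + 1), hside i, Bool.not_not]
  have hper : ∀ i, w (i + N) = w i := fun i => (hw _ _).2 (by simp [Nat.ModEq])
  by_cases hloop : ∃ n, coverProj (w n) = coverProj (w (n + 1))
  · obtain ⟨n, hn⟩ := hloop
    have hnl : adj (coverProj (w n)) (coverProj (w n)) := by simpa [← hn] using hadj n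
    by_cases hstay : ∃ i, i < N - 1 ∧ coverProj (w (n + 1 + i)) = coverProj (w (n + 1 + (i + 1)))
    · obtain ⟨i, hi, hii⟩ := hstay
      have hil : adj (coverProj (w (n + 1 + i))) (coverProj (w (n + 1 + i))) := by
        have := hadj (n + 1 + i)
        rwa [add_assoc (n + 1), ← hii] at this
      by_cases hne : coverProj (w n) = coverProj (w (n + 1 + i))
      · exfalso
        by_cases hs : (w n).isLeft = (w (n + 1 + i)).isLeft
        · refine not_modEq_add n (d := i + 1) (by omega) (by omega) ((hw _ _).1 ?_)
          rw [show n + (i + 1) = n + 1 + i by omega]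
          exact eq_of_coverProj_eq hne hs
        · rcases Nat.eq_zero_or_pos i with rfl | hpos
          · exact hback n (hne.trans hii)
          · refine not_modEq_add (n + 1) (d := i) hpos (by omega) ((hw _ _).1 ?_)
            refine eq_of_coverProj_eq (hn.symm.trans hne) ?_
            rw [hside n]
            revert hs
            cases (w n).isLeft <;> cases (w (n + 1 + i)).isLeft <;> simp
      · right
        refine hasTwoLoopsJoinedByPath_of_walk (i + 1) (fun k => coverProj (w (n + k))) ?_
          (fun k _ => hadj (n + k)) hnl ?_
        · rwa [show n + (i + 1) = n + 1 + i by omega]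
        · rwa [show n + (i + 1) = n + 1 + i by omega]
    · left
      push Not at hstay
      refine hasCycle_of_nonbacktracking (N - 1) (fun k => coverProj (w (n + 1 + k))) (by omega)
        ?_ (fun k _ => hadj (n + 1 + k)) hstay (fun k _ => hback (n + 1 + k))
      change coverProj (w (n + 1)) = _
      rw [show n + 1 + (N - 1) = n + N by omega, hper, hn]
  · left
    push Not at hloop
    refine hasCycle_of_nonbacktracking N (fun k => coverProj (w k)) (by omega) ?_
      (fun k _ => hadj k) (fun k _ => hloop k) (fun k _ => hback k)
    simpa using (congrArg coverProj (hper 0)).symm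

/-- A spider in the double cover whose first two legs project to loopless paths projects to
one of the listed configurations. -/
theorem forbidden_of_two_loopless_legs {V : Type*} {adj : V → V → Prop} (hsymm : Symmetric adj)
    (hcyc : ¬ HasCycle adj) {x a1 b1 c1 a2 b2 c2 a3 b3 c3 : V}
    (hev : [x, b1, b2, b3].Nodup) (hodd : [a1, c1, a2, c2, a3, c3].Nodup)
    (hxa1 : adj x a1) (hab1 : adj a1 b1) (hbc1 : adj b1 c1)
    (hxa2 : adj x a2) (hab2 : adj a2 b2) (hbc2 : adj b2 c2)
    (hxa3 : adj x a3) (hab3 : adj a3 b3) (hbc3 : adj b3 c3)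
    (l1 : a1 ≠ x ∧ a1 ≠ b1 ∧ b1 ≠ c1) (l2 : a2 ≠ x ∧ a2 ≠ b2 ∧ b2 ≠ c2) :
    HasH1 adj ∨ HasH2 adj ∨ HasH3 adj ∨ HasH4 adj := by
  have tri : ∀ {x y z : V}, adj x y → adj y z → adj z x → x ≠ y → y ≠ z → z ≠ x → False := by
    intro x y z h1 h2 h3 h4 h5 h6
    exact hcyc (hasCycle_of_triangle (by simp [h4, h5, h6.symm]) h1 h2 h3)
  have hcx : ∀ {a b c : V}, adj x a → adj a b → adj b c → x ≠ b → a ≠ x → a ≠ b → c ≠ x := by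
    rintro a b c h1 h2 h3 h4 h5 h6 rfl
    exact tri h1 h2 h3 h5.symm h6 h4.symm
  have hba : ∀ {a b a' : V}, adj x a → adj a b → adj x a' → a ≠ a' → a ≠ x → a' ≠ x → b ≠ a' := by
    rintro a b a' h1 h2 h3 h4 h5 h6 rfl
    exact tri h1 h2 (hsymm h3) h5.symm h4 h6
  have hbc : ∀ {a b a' b' c' : V}, adj x a → adj a b → adj x a' → adj a' b' → adj b' c' →
      [x, b, b'].Nodup → [a, a', c'].Nodup → a ≠ x → a ≠ b → a' ≠ x → a' ≠ b' → b' ≠ a →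
      b ≠ c' := by
    rintro a b a' b' c' h1 h2 h3 h4 h5 h6 h7 h8 h9 h10 h11 h12 rfl
    refine hcyc (hasCycle_of_pentagon (x := x) (y := a) (z := b) (u := b') (w := a') ?_ h1 h2
      (hsymm h5) (hsymm h4) (hsymm h3))
    simp only [List.nodup_cons, List.mem_cons, List.not_mem_nil] at *
    grind
  simp only [List.nodup_cons, List.mem_cons, List.not_mem_nil, or_false, not_or,
    not_false_eq_true, List.nodup_nil, and_true] at hev hodd hbc
  have e1 := hcx hxa1 hab1 hbc1 (by grind) l1.1 l1.2.1
  have e2 := hcx hxa2 hab2 hbc2 (by grind) l2.1 l2.2.1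
  have e3 := hba hxa1 hab1 hxa2 (by grind) l1.1 l2.1
  have e4 := hba hxa2 hab2 hxa1 (by grind) l2.1 l1.1
  have e5 := hbc hxa1 hab1 hxa2 hab2 hbc2 (by grind) (by grind) l1.1 l1.2.1 l2.1 l2.2.1 e4
  have e6 := hbc hxa2 hab2 hxa1 hab1 hbc1 (by grind) (by grind) l2.1 l2.2.1 l1.1 l1.2.1 e3
  by_cases h3 : a3 = x
  · subst h3
    right; right; right
    refine ⟨a3, a1, b1, c1, a2, b2, c2, ?_, hxa1, hab1, hbc1, hxa2, hab2, hbc2, hxa3⟩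
    simp only [List.nodup_cons, List.mem_cons, List.not_mem_nil]
    grind
  have f1 := hba hxa1 hab1 hxa3 (by grind) l1.1 h3
  have f2 := hba hxa2 hab2 hxa3 (by grind) l2.1 h3
  by_cases h4 : a3 = b3
  · subst h4
    right; right; left
    refine ⟨x, a1, b1, c1, a2, b2, c2, a3, ?_, hxa1, hab1, hbc1, hxa2, hab2, hbc2, hxa3, hab3⟩
    simp only [List.nodup_cons, List.mem_cons, List.not_mem_nil]
    grind
  have f3 := hba hxa3 hab3 hxa1 (by grind) h3 l1.1
  have f4 := hba hxa3 hab3 hxa2 (by grind) h3 l2.1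
  have f5 := hbc hxa3 hab3 hxa1 hab1 hbc1 (by grind) (by grind) h3 h4 l1.1 l1.2.1 f1
  have f6 := hbc hxa3 hab3 hxa2 hab2 hbc2 (by grind) (by grind) h3 h4 l2.1 l2.2.1 f2
  by_cases h5 : b3 = c3
  · subst h5
    right; left
    refine ⟨x, a1, b1, c1, a2, b2, c2, a3, b3, ?_, hxa1, hab1, hbc1, hxa2, hab2, hbc2, hxa3,
      hab3, hbc3⟩
    simp only [List.nodup_cons, List.mem_cons, List.not_mem_nil]
    grind
  have f7 := hbc hxa1 hab1 hxa3 hab3 hbc3 (by grind) (by grind) l1.1 l1.2.1 h3 h4 f3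
  have f8 := hbc hxa2 hab2 hxa3 hab3 hbc3 (by grind) (by grind) l2.1 l2.2.1 h3 h4 f4
  have f9 := hcx hxa3 hab3 hbc3 (by grind) h3 h4
  left
  refine ⟨x, a1, b1, c1, a2, b2, c2, a3, b3, c3, ?_, hxa1, hab1, hbc1, hxa2, hab2, hbc2, hxa3,
    hab3, hbc3⟩
  simp only [List.nodup_cons, List.mem_cons, List.not_mem_nil]
  grind

/-- If no two looped vertices are joined by a path, then of any two legs of a spider in the
double cover at least one projects to a path using no loop. -/
theorem loopless_leg_or_loopless_leg {V : Type*} {adj : V → V → Prop} (hsymm : Symmetric adj)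
    (hloops : ¬ HasTwoLoopsJoinedByPath adj) {x a1 b1 c1 a2 b2 c2 : V}
    (hev : [x, b1, b2].Nodup) (hodd : [a1, c1, a2, c2].Nodup)
    (hxa1 : adj x a1) (hab1 : adj a1 b1) (hbc1 : adj b1 c1)
    (hxa2 : adj x a2) (hab2 : adj a2 b2) (hbc2 : adj b2 c2) :
    (a1 ≠ x ∧ a1 ≠ b1 ∧ b1 ≠ c1) ∨ (a2 ≠ x ∧ a2 ≠ b2 ∧ b2 ≠ c2) := by
  have hrev : ∀ {u v : V}, Relation.ReflTransGen adj u v → Relation.ReflTransGen adj v u :=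
    fun h => Relation.ReflTransGen.mono (fun _ _ h' => hsymm h')
      _ _ (Relation.ReflTransGen.swap _ _ h)
  by_contra! hcon
  have hleg : ∀ {a b c : V}, adj x a → adj a b → adj b c → (a ≠ x → a ≠ b → b = c) →
      ∃ u, adj u u ∧ Relation.ReflTransGen adj x u ∧ (u = x ∧ a = x ∨ u = b ∧ (a = b ∨ b = c)) := by
    intro a b c h1 h2 h3 h4
    by_cases hax : a = x
    · subst hax
      exact ⟨a, h1, .refl, by simp⟩
    by_cases hab : a = b
    · subst hab
      exact ⟨a, h2, .single h1, by simp⟩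
    · obtain rfl := h4 hax hab
      exact ⟨b, h3, .tail (.single h1) h2, by simp⟩
  obtain ⟨u, hu, hxu, hu'⟩ := hleg hxa1 hab1 hbc1 hcon.1
  obtain ⟨v, hv, hxv, hv'⟩ := hleg hxa2 hab2 hbc2 hcon.2
  by_cases huv : u = v
  · simp only [List.nodup_cons, List.mem_cons, List.not_mem_nil] at hev hodd
    grind
  · exact hloops (hasTwoLoopsJoinedByPath_of_reflTransGen
      ((hrev hxu).trans hxv) huv hu hv)

theorem forbidden_of_projected_spider {V : Type*} {adj : V → V → Prop} (hsymm : Symmetric adj)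
    (hcyc : ¬ HasCycle adj) (hloops : ¬ HasTwoLoopsJoinedByPath adj)
    {x a1 b1 c1 a2 b2 c2 a3 b3 c3 : V}
    (hev : [x, b1, b2, b3].Nodup) (hodd : [a1, c1, a2, c2, a3, c3].Nodup)
    (hxa1 : adj x a1) (hab1 : adj a1 b1) (hbc1 : adj b1 c1)
    (hxa2 : adj x a2) (hab2 : adj a2 b2) (hbc2 : adj b2 c2)
    (hxa3 : adj x a3) (hab3 : adj a3 b3) (hbc3 : adj b3 c3) :
    HasH1 adj ∨ HasH2 adj ∨ HasH3 adj ∨ HasH4 adj := by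
  have h12 := loopless_leg_or_loopless_leg hsymm hloops (by grind) (by grind)
    hxa1 hab1 hbc1 hxa2 hab2 hbc2
  have h13 := loopless_leg_or_loopless_leg hsymm hloops (by grind) (by grind)
    hxa1 hab1 hbc1 hxa3 hab3 hbc3
  have h23 := loopless_leg_or_loopless_leg hsymm hloops (by grind) (by grind)
    hxa2 hab2 hbc2 hxa3 hab3 hbc3
  by_cases h1 : a1 ≠ x ∧ a1 ≠ b1 ∧ b1 ≠ c1
  · by_cases h2 : a2 ≠ x ∧ a2 ≠ b2 ∧ b2 ≠ c2
    · exact forbidden_of_two_loopless_legs hsymm hcyc hev hodd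
        hxa1 hab1 hbc1 hxa2 hab2 hbc2 hxa3 hab3 hbc3 h1 h2
    · exact forbidden_of_two_loopless_legs hsymm hcyc (by grind) (by grind)
        hxa1 hab1 hbc1 hxa3 hab3 hbc3 hxa2 hab2 hbc2 h1 (h23.resolve_left h2)
  · exact forbidden_of_two_loopless_legs hsymm hcyc (by grind) (by grind)
      hxa2 hab2 hbc2 hxa3 hab3 hbc3 hxa1 hab1 hbc1 (h12.resolve_left h1) (h13.resolve_left h1)

theorem exists_inr_of_adjB_inl {V : Type*} {adj : V → V → Prop} {v : V} {w : V ⊕ V}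
    (h : adjB adj (Sum.inl v) w) : ∃ u, w = Sum.inr u ∧ adj v u := by
  rcases w with w | w <;> simp_all [adjB]

theorem exists_inl_of_adjB_inr {V : Type*} {adj : V → V → Prop} {v : V} {w : V ⊕ V}
    (h : adjB adj (Sum.inr v) w) : ∃ u, w = Sum.inl u ∧ adj v u := by
  rcases w with w | w <;> simp_all [adjB]

theorem forbidden_of_hasH1_adjB {V : Type*} {adj : V → V → Prop} (hsymm : Symmetric adj)
    (hcyc : ¬ HasCycle adj) (hloops : ¬ HasTwoLoopsJoinedByPath adj) (h : HasH1 (adjB adj)) :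
    HasH1 adj ∨ HasH2 adj ∨ HasH3 adj ∨ HasH4 adj := by
  obtain ⟨x, a1, b1, c1, a2, b2, c2, a3, b3, c3, hnd, hxa1, hab1, hbc1, hxa2, hab2, hbc2,
    hxa3, hab3, hbc3⟩ := h
  rcases x with x | x
  · obtain ⟨a1, rfl, hxa1⟩ := exists_inr_of_adjB_inl hxa1
    obtain ⟨b1, rfl, hab1⟩ := exists_inl_of_adjB_inr hab1
    obtain ⟨c1, rfl, hbc1⟩ := exists_inr_of_adjB_inl hbc1
    obtain ⟨a2, rfl, hxa2⟩ := exists_inr_of_adjB_inl hxa2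
    obtain ⟨b2, rfl, hab2⟩ := exists_inl_of_adjB_inr hab2
    obtain ⟨c2, rfl, hbc2⟩ := exists_inr_of_adjB_inl hbc2
    obtain ⟨a3, rfl, hxa3⟩ := exists_inr_of_adjB_inl hxa3
    obtain ⟨b3, rfl, hab3⟩ := exists_inl_of_adjB_inr hab3
    obtain ⟨c3, rfl, hbc3⟩ := exists_inr_of_adjB_inl hbc3
    refine forbidden_of_projected_spider hsymm hcyc hloops ?_ ?_
      hxa1 hab1 hbc1 hxa2 hab2 hbc2 hxa3 hab3 hbc3 <;>
    simp at hnd ⊢ <;> tauto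
  · obtain ⟨a1, rfl, hxa1⟩ := exists_inl_of_adjB_inr hxa1
    obtain ⟨b1, rfl, hab1⟩ := exists_inr_of_adjB_inl hab1
    obtain ⟨c1, rfl, hbc1⟩ := exists_inl_of_adjB_inr hbc1
    obtain ⟨a2, rfl, hxa2⟩ := exists_inl_of_adjB_inr hxa2
    obtain ⟨b2, rfl, hab2⟩ := exists_inr_of_adjB_inl hab2
    obtain ⟨c2, rfl, hbc2⟩ := exists_inl_of_adjB_inr hbc2
    obtain ⟨a3, rfl, hxa3⟩ := exists_inl_of_adjB_inr hxa3
    obtain ⟨b3, rfl, hab3⟩ := exists_inr_of_adjB_inl hab3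
    obtain ⟨c3, rfl, hbc3⟩ := exists_inl_of_adjB_inr hbc3
    refine forbidden_of_projected_spider hsymm hcyc hloops ?_ ?_
      hxa1 hab1 hbc1 hxa2 hab2 hbc2 hxa3 hab3 hbc3 <;>
    simp at hnd ⊢ <;> tauto

theorem hasH1_adjB_of_projected_spider {V : Type*} {adj : V → V → Prop}
    {x a1 b1 c1 a2 b2 c2 a3 b3 c3 : V}
    (hev : [x, b1, b2, b3].Nodup) (hodd : [a1, c1, a2, c2, a3, c3].Nodup)
    (hxa1 : adj x a1) (hab1 : adj a1 b1) (hbc1 : adj b1 c1)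
    (hxa2 : adj x a2) (hab2 : adj a2 b2) (hbc2 : adj b2 c2)
    (hxa3 : adj x a3) (hab3 : adj a3 b3) (hbc3 : adj b3 c3) : HasH1 (adjB adj) := by
  refine ⟨.inl x, .inr a1, .inl b1, .inr c1, .inr a2, .inl b2, .inr c2, .inr a3, .inl b3,
    .inr c3, ?_, hxa1, hab1, hbc1, hxa2, hab2, hbc2, hxa3, hab3, hbc3⟩
  simp at hev hodd ⊢
  tauto

/-- `G` contains a cycle, or two looped vertices joined by a path,
or one of `H_1, H_2, H_3, H_4` as a subgraph, iff `B_G` contains a cycle or a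
3-spider as a subgraph. -/
theorem forbidden_subgraphs_iff_double_cover {V : Type*} [Fintype V]
    (adj : V → V → Prop) (hsymm : Symmetric adj) (hniso : ∀ v, ∃ u, adj v u) :
    (HasCycle adj ∨ HasTwoLoopsJoinedByPath adj ∨
      HasH1 adj ∨ HasH2 adj ∨ HasH3 adj ∨ HasH4 adj) ↔
    (HasCycle (adjB adj) ∨ HasH1 (adjB adj)) := by
  constructor
  · rintro (h | h | h | h | h | h)
    · exact .inl h.doubleCover
    · exact .inl (h.hasCycle_doubleCover hsymm)
    · obtain ⟨x, a1, b1, c1, a2, b2, c2, a3, b3, c3, hnd, hxa1, hab1, hbc1, hxa2, hab2, hbc2,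
        hxa3, hab3, hbc3⟩ := h
      exact .inr (hasH1_adjB_of_projected_spider (by grind) (by grind)
        hxa1 hab1 hbc1 hxa2 hab2 hbc2 hxa3 hab3 hbc3)
    · obtain ⟨x, a1, b1, c1, a2, b2, c2, a3, b3, hnd, hxa1, hab1, hbc1, hxa2, hab2, hbc2,
        hxa3, hab3, hb3⟩ := h
      exact .inr (hasH1_adjB_of_projected_spider (by grind) (by grind)
        hxa1 hab1 hbc1 hxa2 hab2 hbc2 hxa3 hab3 hb3)
    · obtain ⟨x, a1, b1, c1, a2, b2, c2, a3, hnd, hxa1, hab1, hbc1, hxa2, hab2, hbc2,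
        hxa3, ha3⟩ := h
      exact .inr (hasH1_adjB_of_projected_spider (by grind) (by grind)
        hxa1 hab1 hbc1 hxa2 hab2 hbc2 hxa3 ha3 (hsymm hxa3))
    · obtain ⟨x, a1, b1, c1, a2, b2, c2, hnd, hxa1, hab1, hbc1, hxa2, hab2, hbc2, hx⟩ := h
      exact .inr (hasH1_adjB_of_projected_spider (by grind) (by grind)
        hxa1 hab1 hbc1 hxa2 hab2 hbc2 hx hxa1 hab1)
  · intro h
    by_cases hcyc : HasCycle adj
    · exact .inl hcyc
    by_cases hloops : HasTwoLoopsJoinedByPath adj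
    · exact .inr (.inl hloops)
    rcases h with h | h
    · exact ((hasCycle_or_hasTwoLoops_of_hasCycle_adjB h).elim hcyc hloops).elim
    · exact .inr (.inr (forbidden_of_hasH1_adjB hsymm hcyc hloops h))
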